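/- Let d ≥ 2, p ∈ (1, d), and 0 < r ≤ R ≤ 1. Then there exists a constant C depending only on p and d such that for every smooth function f on the closed ball B(0,R) ⊂ ℝ^d, the trace satisfies ∫_{|x|=r} |f|^p dH^{d−1} ≤ C · max(r^{d−1} R^{−d}, r^{p−1}) · (∫_{B(0,R)} |f|^p + |∇f|^p dx). -/

import Mathlib

open MeasureTheory
open Set Metric Filter Topology
open scoped NNReal ENNReal Pointwise

section Polar
variable {E : Type*} [NormedAddCommGroup E] [NormedSpace ℝ E] [FiniteDimensional ℝ E]
  [Nontrivial E] [MeasurableSpace E] [BorelSpace E] (μ : Measure E) [μ.IsAddHaarMeasure]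

/-- Integration in polar coordinates. -/
theorem lintegral_eq_lintegral_toSphere {h : E → ℝ≥0∞} (hh : Measurable h) :
    ∫⁻ x, h x ∂μ = ∫⁻ ω, ∫⁻ t in Ioi (0 : ℝ),
      ENNReal.ofReal (t ^ (Module.finrank ℝ E - 1)) * h (t • (ω : E)) ∂volume ∂μ.toSphere := by
  have hmeas : Measurable fun z : sphere (0 : E) 1 × Ioi (0 : ℝ) ↦ h ((z.2 : ℝ) • (z.1 : E)) :=
    hh.comp (by fun_prop)
  calc
    ∫⁻ x, h x ∂μ = ∫⁻ x : ({(0)}ᶜ : Set E), h x ∂(μ.comap (↑)) := by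
      rw [lintegral_subtype_comap (measurableSet_singleton _).compl, restrict_compl_singleton]
    _ = ∫⁻ z, h ((z.2 : ℝ) • (z.1 : E))
          ∂μ.toSphere.prod (.volumeIoiPow (Module.finrank ℝ E - 1)) := by
      rw [← μ.measurePreserving_homeomorphUnitSphereProd.lintegral_comp hmeas]
      refine lintegral_congr fun x ↦ ?_
      congr 1
      exact congrArg Subtype.val ((homeomorphUnitSphereProd E).symm_apply_apply x).symm
    _ = _ := by
      rw [lintegral_prod _ hmeas.aemeasurable]
      refine lintegral_congr fun ω ↦ ?_
      rw [Measure.volumeIoiPow, lintegral_withDensity_eq_lintegral_mul _ (by fun_prop)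
        (by fun_prop), ← lintegral_subtype_comap measurableSet_Ioi]
      rfl

theorem measure_shell_le {T : Set (sphere (0 : E) 1)} (hT : MeasurableSet T) (ε : ℝ) :
    μ {x | 1 - ε < ‖x‖ ∧ ‖x‖ < 1 ∧ ‖x‖⁻¹ • x ∈ ((↑) '' T : Set E)} ≤
      ENNReal.ofReal ε * μ.toSphere T := by
  have hA : MeasurableSet {x : E | 1 - ε < ‖x‖ ∧ ‖x‖ < 1 ∧ ‖x‖⁻¹ • x ∈ ((↑) '' T : Set E)} := by
    have h1 : MeasurableSet ((↑) '' T : Set E) :=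
      (MeasurableEmbedding.subtype_coe isClosed_sphere.measurableSet).measurableSet_image.2 hT
    have h2 : Measurable fun x : E ↦ ‖x‖⁻¹ • x := by fun_prop
    exact (measurableSet_lt measurable_const measurable_norm).inter
      ((measurableSet_lt measurable_norm measurable_const).inter (h2 h1))
  rw [← lintegral_indicator_one hA,
    lintegral_eq_lintegral_toSphere μ (measurable_one.indicator hA)]
  calc
    _ ≤ ∫⁻ ω, T.indicator (fun _ ↦ ENNReal.ofReal ε) ω ∂μ.toSphere := by
      refine lintegral_mono fun ω ↦ ?_
      by_cases hω : ω ∈ T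
      · rw [indicator_of_mem hω]
        calc
          _ ≤ ∫⁻ t in Ioi (0 : ℝ), (Ioo (1 - ε) 1).indicator 1 t := by
            refine setLIntegral_mono' measurableSet_Ioi fun t (ht : 0 < t) ↦ ?_
            by_cases h : t ∈ Ioo (1 - ε) 1
            · rw [indicator_of_mem h]
              refine mul_le_one' ?_ (indicator_le_self' (by simp) _)
              rw [ENNReal.ofReal_le_one]
              exact pow_le_one₀ ht.le h.2.le
            · rw [indicator_of_notMem, mul_zero]
              · exact zero_le
              · rintro ⟨h1, h2, -⟩
                simp only [norm_smul, norm_eq_of_mem_sphere, Real.norm_of_nonneg ht.le,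
                  mul_one] at h1 h2
                exact h ⟨h1, h2⟩
          _ ≤ ∫⁻ t, (Ioo (1 - ε) 1).indicator 1 t := setLIntegral_le_lintegral _ _
          _ = ENNReal.ofReal ε := by
            rw [lintegral_indicator_one measurableSet_Ioo]; simp
      · rw [indicator_of_notMem hω, nonpos_iff_eq_zero]
        refine setLIntegral_eq_zero measurableSet_Ioi fun t (ht : 0 < t) ↦ ?_
        rw [indicator_of_notMem, mul_zero, Pi.zero_apply]
        rintro ⟨-, -, ω', hω', h⟩
        simp only [norm_smul, norm_eq_of_mem_sphere, Real.norm_of_nonneg ht.le, mul_one,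
          inv_smul_smul₀ ht.ne'] at h
        exact hω (Subtype.ext h ▸ hω')
    _ = _ := by rw [lintegral_indicator_const hT]

theorem exists_finite_isSeparated_isCover {X : Type*} [MetricSpace X] [CompactSpace X] {ε : ℝ≥0}
    (hε : ε ≠ 0) (K : Set X) :
    ∃ N ⊆ K, N.Finite ∧ IsSeparated ε N ∧ IsCover ε K N := by
  have hK : packingNumber ε K ≠ ⊤ := by
    obtain ⟨N, -, hN, hc⟩ := exists_finite_isCover_of_totallyBounded (ε := ε / 2) (s := K)
      (by simpa using hε) (isCompact_univ.totallyBounded.subset (subset_univ _))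
    have := (packingNumber_two_mul_le_externalCoveringNumber (ε / 2) K).trans
      hc.externalCoveringNumber_le_encard
    rw [mul_div_cancel₀ _ two_ne_zero] at this
    exact (this.trans_lt hN.encard_lt_top).ne
  refine ⟨maximalSeparatedSet ε K, maximalSeparatedSet_subset, ?_,
    isSeparated_maximalSeparatedSet, isCover_maximalSeparatedSet hK⟩
  rw [← encard_lt_top_iff, encard_maximalSeparatedSet hK]
  exact hK.lt_top
end Polar

section Hausdorff
variable {E : Type*} [NormedAddCommGroup E] [NormedSpace ℝ E] [FiniteDimensional ℝ E]
  [Nontrivial E] [MeasurableSpace E] [BorelSpace E] (μ : Measure E) [μ.IsAddHaarMeasure]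

theorem card_mul_measure_ball_le_toSphere_cthickening {ε : ℝ≥0} (hε : 0 < ε) (hε1 : ε ≤ 1)
    {K : Set (sphere (0 : E) 1)} (N : Finset (sphere (0 : E) 1)) (hNK : (N : Set _) ⊆ K)
    (hN : IsSeparated (ε : ℝ≥0∞) (N : Set (sphere (0 : E) 1))) :
    N.card * (ENNReal.ofReal ((ε / 4 : ℝ) ^ Module.finrank ℝ E) * μ (ball 0 1)) ≤
      ENNReal.ofReal ε * μ.toSphere (cthickening (2 * ε) K) := by
  have hε' : (0 : ℝ) < ε := by exact_mod_cast hε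
  have hε1' : (ε : ℝ) ≤ 1 := by exact_mod_cast hε1
  calc
    _ = ∑ x ∈ N, μ (ball ((1 - ε / 2 : ℝ) • (x : E)) (ε / 4)) := by
      simp_rw [μ.addHaar_ball_of_pos _ (show (0 : ℝ) < ε / 4 by positivity)]
      simp
    _ = μ (⋃ x ∈ N, ball ((1 - ε / 2 : ℝ) • (x : E)) (ε / 4)) := by
      refine (measure_biUnion_finset (fun x hx y hy hxy ↦ ball_disjoint_ball ?_)
        fun _ _ ↦ measurableSet_ball).symm
      have h : (ε : ℝ) < dist x y := by
        have : (ε : ℝ≥0∞) < edist x y := hN hx hy hxy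
        rw [edist_nndist] at this
        exact_mod_cast this
      rw [dist_eq_norm, ← smul_sub, norm_smul, Real.norm_of_nonneg (by linarith),
        ← dist_eq_norm, ← Subtype.dist_eq]
      nlinarith
    _ ≤ _ := by
      refine (measure_mono ?_).trans
        (measure_shell_le μ isClosed_cthickening.measurableSet ε)
      refine iUnion₂_subset fun x hx y hy ↦ ?_
      rw [mem_ball, dist_eq_norm] at hy
      have hx1 : ‖(1 - ε / 2 : ℝ) • (x : E)‖ = 1 - ε / 2 := by
        rw [norm_smul, norm_eq_of_mem_sphere, mul_one, Real.norm_of_nonneg (by linarith)]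
      have habs := (abs_le.1 (abs_norm_sub_norm_le y ((1 - ε / 2 : ℝ) • (x : E))))
      rw [hx1] at habs
      have h1 : 1 - ε < ‖y‖ := by linarith [habs.1]
      have h2 : ‖y‖ < 1 := by linarith [habs.2]
      have hy0 : 0 < ‖y‖ := by linarith
      refine ⟨h1, h2, ⟨‖y‖⁻¹ • y, ?_⟩, ?_, rfl⟩
      · simp [norm_smul, hy0.ne']
      · refine mem_cthickening_of_dist_le _ x _ _ (hNK hx) ?_
        rw [Subtype.dist_eq, dist_eq_norm]
        have e : ‖y‖⁻¹ • y - x = (‖y‖⁻¹ - 1) • y + (y - (1 - ε / 2 : ℝ) • (x : E))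
            + (-(ε / 2) : ℝ) • (x : E) := by module
        have e1 : ‖(‖y‖⁻¹ - 1) • y‖ = 1 - ‖y‖ := by
          rw [norm_smul, Real.norm_of_nonneg (by linarith [(one_le_inv₀ hy0).2 h2.le]), sub_mul,
            inv_mul_cancel₀ hy0.ne', one_mul]
        have e2 : ‖(-(ε / 2) : ℝ) • (x : E)‖ = ε / 2 := by
          rw [norm_smul, norm_eq_of_mem_sphere, mul_one, norm_neg,
            Real.norm_of_nonneg (by positivity)]
        rw [e]
        refine (norm_add₃_le).trans ?_
        rw [e1, e2]
        linarith [habs.1]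

theorem card_mul_rpow_le_toSphere_cthickening {ε : ℝ≥0} (hε : 0 < ε) (hε1 : ε ≤ 1)
    {K : Set (sphere (0 : E) 1)} (N : Finset (sphere (0 : E) 1)) (hNK : (N : Set _) ⊆ K)
    (hN : IsSeparated (ε : ℝ≥0∞) (N : Set (sphere (0 : E) 1))) :
    N.card * (2 * ε : ℝ≥0∞) ^ ((Module.finrank ℝ E : ℝ) - 1) ≤
      8 ^ Module.finrank ℝ E * (μ (ball 0 1))⁻¹ * μ.toSphere (cthickening (2 * ε) K) := by
  set n := Module.finrank ℝ E
  have hn1 : 1 ≤ n := Module.finrank_pos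
  have hb0 : μ (ball 0 1) ≠ 0 := (measure_ball_pos μ 0 one_pos).ne'
  have hb1 : μ (ball 0 1) ≠ ⊤ := measure_ball_lt_top.ne
  set C : ℝ≥0∞ := 8 ^ n * (μ (ball 0 1))⁻¹ with hC
  have h := card_mul_measure_ball_le_toSphere_cthickening μ hε hε1 N hNK hN
  have hε0 : (ε : ℝ≥0∞) ≠ 0 := by exact_mod_cast hε.ne'
  have h1 : (2 * ε : ℝ≥0∞) ^ ((n : ℝ) - 1) ≤ C * ((ε : ℝ≥0∞))⁻¹ *
      (ENNReal.ofReal ((ε / 4 : ℝ) ^ n) * μ (ball 0 1)) := by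
    have e1 : ENNReal.ofReal ((ε / 4 : ℝ) ^ n) = (ε / 4 : ℝ≥0∞) ^ n := by
      rw [ENNReal.ofReal_pow (by positivity), ENNReal.ofReal_div_of_pos (by norm_num)]
      simp
    have e2 : (2 * ε : ℝ≥0∞) ^ ((n : ℝ) - 1) = (2 * ε : ℝ≥0∞) ^ (n - 1) := by
      rw [← ENNReal.rpow_natCast]; congr 1; push_cast [hn1]; ring
    have e3 : (8 : ℝ≥0∞) ^ n * (ε / 4 : ℝ≥0∞) ^ n = (2 * ε) ^ (n - 1) * (2 * ε) := by
      rw [← pow_succ, Nat.sub_add_cancel hn1, ← mul_pow]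
      congr 1
      rw [show (8 : ℝ≥0∞) = 2 * 4 by norm_num, mul_assoc,
        ENNReal.mul_div_cancel (by norm_num) (by norm_num)]
    calc
      _ ≤ (2 * ε : ℝ≥0∞) ^ (n - 1) * 2 := by
        rw [e2]; exact le_mul_of_one_le_right' (by norm_num)
      _ = (8 : ℝ≥0∞) ^ n * (ε / 4 : ℝ≥0∞) ^ n * (ε : ℝ≥0∞)⁻¹ *
          ((μ (ball 0 1))⁻¹ * μ (ball 0 1)) := by
        rw [e3, ENNReal.inv_mul_cancel hb0 hb1, mul_one, mul_assoc, mul_assoc,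
          ENNReal.mul_inv_cancel hε0 ENNReal.coe_ne_top, mul_one]
      _ = _ := by rw [e1, hC]; ring
  calc
    _ ≤ N.card * (C * ((ε : ℝ≥0∞))⁻¹ *
      (ENNReal.ofReal ((ε / 4 : ℝ) ^ n) * μ (ball 0 1))) := by gcongr
    _ = C * ((ε : ℝ≥0∞))⁻¹ *
      (N.card * (ENNReal.ofReal ((ε / 4 : ℝ) ^ n) * μ (ball 0 1))) := by ring
    _ ≤ C * ((ε : ℝ≥0∞))⁻¹ *
      (ENNReal.ofReal ε * μ.toSphere (cthickening (2 * ε) K)) := by gcongr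
    _ = _ := by
      rw [ENNReal.ofReal_coe_nnreal, mul_assoc, ← mul_assoc _ (ε : ℝ≥0∞),
        ENNReal.inv_mul_cancel hε0 ENNReal.coe_ne_top, one_mul]

/-- On the unit sphere, the Hausdorff measure of codimension one is bounded on closed sets by a
multiple of the surface measure. -/
theorem exists_hausdorffMeasure_le_mul_toSphere :
    ∃ C : ℝ≥0, ∀ K : Set (sphere (0 : E) 1), IsClosed K →
      μH[(Module.finrank ℝ E : ℝ) - 1] K ≤ C * μ.toSphere K := by
  set n := Module.finrank ℝ E
  have hn1 : 1 ≤ n := Module.finrank_pos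
  have hb0 : μ (ball 0 1) ≠ 0 := (measure_ball_pos μ 0 one_pos).ne'
  set C : ℝ≥0∞ := 8 ^ n * (μ (ball 0 1))⁻¹
  have hCtop : C ≠ ⊤ := by finiteness
  refine ⟨C.toNNReal, fun K hK ↦ ?_⟩
  rw [ENNReal.coe_toNNReal hCtop]
  let ε : ℕ → ℝ≥0 := fun k ↦ 1 / (k + 1)
  have hε0 (k) : 0 < ε k := by positivity
  have hε1 (k) : ε k ≤ 1 := by
    simp only [ε]; rw [div_le_one (by positivity)]; simp
  have hεlim : Tendsto ε atTop (𝓝 0) := tendsto_one_div_add_atTop_nhds_zero_nat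
  choose N hNK hNfin hNsep hNcov using
    fun k ↦ exists_finite_isSeparated_isCover (hε0 k).ne' K
  have hfin (k : ℕ) : Fintype (N k) := (hNfin k).fintype
  have hdiam (k) (x : sphere (0 : E) 1) : ediam (closedBall x (ε k)) ≤ 2 * ε k := by
    rw [← closedEBall_coe]
    exact ediam_closedEBall_le
  have hlim2 : Tendsto (fun k ↦ (2 * ε k : ℝ≥0∞)) atTop (𝓝 0) := by
    have : Tendsto (fun k ↦ (ε k : ℝ≥0∞)) atTop (𝓝 0) := by
      simpa using ENNReal.tendsto_coe.2 hεlim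
    simpa using ENNReal.Tendsto.const_mul (a := 2) this (.inr (by norm_num))
  calc
    _ ≤ liminf (fun k ↦ ∑ x : N k, ediam (closedBall (x : sphere (0 : E) 1) (ε k))
          ^ ((n : ℝ) - 1)) atTop := by
      refine Measure.hausdorffMeasure_le_liminf_sum _ K (fun k ↦ (2 * ε k : ℝ≥0∞)) hlim2 _
        (.of_forall fun k x ↦ hdiam k x) (.of_forall fun k ↦ ?_)
      simpa only [iUnion_coe_set] using isCover_iff_subset_iUnion_closedBall.1 (hNcov k)
    _ ≤ liminf (fun k ↦ C * μ.toSphere (cthickening (2 * ε k) K)) atTop := by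
      refine liminf_le_liminf (.of_forall fun k ↦ ?_)
      refine le_trans ?_ (card_mul_rpow_le_toSphere_cthickening μ (hε0 k) (hε1 k) (hNfin k).toFinset (by simpa using hNK k)
        (by simpa using hNsep k))
      refine (Finset.sum_le_card_nsmul _ _ ((2 * ε k : ℝ≥0∞) ^ ((n : ℝ) - 1)) fun x _ ↦ ?_).trans
        (le_of_eq ?_)
      · exact ENNReal.rpow_le_rpow (hdiam k x) (by simpa using hn1)
      · rw [nsmul_eq_mul, Finset.card_univ, ← Set.toFinset_card]
        congr 3
        ext; simp
    _ = C * μ.toSphere K := by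
      refine Tendsto.liminf_eq (ENNReal.Tendsto.const_mul ?_ (.inr hCtop))
      refine (tendsto_measure_cthickening_of_isCompact hK.isCompact).comp ?_
      have : Tendsto (fun k ↦ (ε k : ℝ)) atTop (𝓝 0) := by
        simpa using NNReal.tendsto_coe.2 hεlim
      simpa using this.const_mul 2

theorem exists_setLIntegral_sphere_le :
    ∃ C : ℝ≥0, ∀ r : ℝ, 0 < r → ∀ g : E → ℝ, Continuous g → 0 ≤ g →
      ∫⁻ x in sphere (0 : E) r, ENNReal.ofReal (g x) ∂μH[(Module.finrank ℝ E : ℝ) - 1] ≤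
        C * ∫⁻ ω : sphere (0 : E) 1,
          ENNReal.ofReal (r ^ (Module.finrank ℝ E - 1) * g (r • (ω : E))) ∂μ.toSphere := by
  have hn1 : 1 ≤ Module.finrank ℝ E := Module.finrank_pos
  obtain ⟨C, hC⟩ := exists_hausdorffMeasure_le_mul_toSphere μ
  refine ⟨C, fun r hr g hg hg0 ↦ ?_⟩
  have hgr : Continuous fun ω : sphere (0 : E) 1 ↦ g (r • (ω : E)) := by fun_prop
  have hrpow : (‖r‖₊ ^ ((Module.finrank ℝ E : ℝ) - 1) : ℝ≥0) =
      ENNReal.ofReal (r ^ (Module.finrank ℝ E - 1)) := by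
    rw [← Nat.cast_pred hn1, NNReal.rpow_natCast, ENNReal.ofReal_pow hr.le,
      ← Real.enorm_of_nonneg hr.le, ENNReal.coe_pow, enorm_eq_nnnorm]
  simp_rw [ENNReal.ofReal_mul (pow_nonneg hr.le (Module.finrank ℝ E - 1))]
  rw [lintegral_const_mul _ (by fun_prop),
    lintegral_eq_lintegral_meas_le _ (.of_forall fun x ↦ hg0 x) hg.aemeasurable,
    lintegral_eq_lintegral_meas_le μ.toSphere (f := fun ω : sphere (0 : E) 1 ↦ g (r • (ω : E)))
      (.of_forall fun ω ↦ hg0 _) hgr.aemeasurable,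
    ← mul_assoc, ← lintegral_const_mul' _ _ (by finiteness)]
  refine lintegral_mono fun t ↦ ?_
  have hK : IsClosed {ω : sphere (0 : E) 1 | t ≤ g (r • (ω : E))} :=
    isClosed_le continuous_const hgr
  have hset : {x | t ≤ g x} ∩ sphere (0 : E) r =
      r • ((↑) '' {ω : sphere (0 : E) 1 | t ≤ g (r • (ω : E))} : Set E) := by
    ext x
    simp only [mem_inter_iff, mem_ofPred_eq, mem_smul_set, mem_image]
    constructor
    · rintro ⟨h1, h2⟩
      have hx : r • r⁻¹ • x = x := smul_inv_smul₀ hr.ne' x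
      refine ⟨r⁻¹ • x, ⟨⟨r⁻¹ • x, ?_⟩, by simpa only [hx] using h1, rfl⟩, hx⟩
      rw [mem_sphere_zero_iff_norm] at h2
      simp [norm_smul, h2, abs_of_pos hr, hr.ne']
    · rintro ⟨_, ⟨ω, hω, rfl⟩, rfl⟩
      exact ⟨hω, by simp [norm_smul, abs_of_pos hr]⟩
  rw [Measure.restrict_apply (isClosed_le continuous_const hg).measurableSet, hset,
    Measure.hausdorffMeasure_smul₀ (by simpa using hn1) hr.ne',
    isometry_subtype_coe.hausdorffMeasure_image (.inl (by simpa using hn1)), ENNReal.smul_def,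
    hrpow, smul_eq_mul, mul_comm (C : ℝ≥0∞), mul_assoc]
  gcongr
  exact hC _ hK

end Hausdorff

section OneDim

theorem integral_rpow_neg_le {a b k : ℝ} (ha : 0 < a) (hab : a ≤ b) (hk : 1 < k) :
    ∫ t in a..b, t ^ (-k) ≤ a ^ (1 - k) / (k - 1) := by
  rw [integral_rpow (.inr ⟨by linarith, by simp [uIcc_of_le hab, ha]⟩),
    show -k + 1 = -(k - 1) by ring, div_neg, ← neg_div, show 1 - k = -(k - 1) by ring]
  have : 0 ≤ b ^ (-(k - 1)) := Real.rpow_nonneg (by linarith) _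
  gcongr
  linarith

/-- Hölder's inequality with the radial weight `t ^ (D - 1)`. -/
theorem rpow_integral_le_mul_integral_rpow_mul {p D a b : ℝ} (hp : 1 < p) (hpD : p < D)
    (ha : 0 < a) (hab : a ≤ b) {w : ℝ → ℝ} (hw : Continuous w) (hw0 : 0 ≤ w) :
    (∫ t in a..b, w t) ^ p ≤ ((p - 1) / (D - p)) ^ (p - 1) * a ^ (p - D) *
      ∫ t in a..b, t ^ (D - 1) * w t ^ p := by
  have hp0 : 0 < p := by linarith
  have hpq := Real.HolderConjugate.conjExponent hp
  set q := p.conjExponent with hq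
  have hq0 : 0 < q := hpq.symm.pos
  have hpq1 : q / p = 1 / (p - 1) := by
    rw [hq, Real.conjExponent]; field_simp
  set k := (D - 1) / (p - 1) with hk
  have hk1 : 1 < k := by rw [hk, one_lt_div (by linarith)]; linarith
  have hcont {e : ℝ} : ContinuousOn (fun t : ℝ ↦ t ^ e) (Icc a b) := fun t ht ↦
    (Real.continuousAt_rpow_const _ _ (.inl (ha.trans_le ht.1).ne')).continuousWithinAt
  have hmem {f : ℝ → ℝ} (hf : ContinuousOn f (Icc a b)) (s : ℝ≥0∞) :
      MemLp f s (volume.restrict (Ioc a b)) := by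
    obtain ⟨M, hM⟩ := isCompact_Icc.exists_bound_of_continuousOn hf
    refine .of_bound ((hf.mono Ioc_subset_Icc_self).aestronglyMeasurable measurableSet_Ioc) M ?_
    filter_upwards [ae_restrict_mem measurableSet_Ioc] with t ht using hM t (Ioc_subset_Icc_self ht)
  have holder := integral_mul_le_Lp_mul_Lq_of_nonneg (μ := volume.restrict (Ioc a b)) hpq
    (f := fun t ↦ t ^ ((D - 1) / p) * w t) (g := fun t ↦ t ^ (-((D - 1) / p)))
    (by filter_upwards [ae_restrict_mem measurableSet_Ioc] with t ht
        exact mul_nonneg (Real.rpow_nonneg (ha.trans ht.1).le _) (hw0 t))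
    (by filter_upwards [ae_restrict_mem measurableSet_Ioc] with t ht
        exact Real.rpow_nonneg (ha.trans ht.1).le _)
    (hmem (hcont.mul hw.continuousOn) _) (hmem hcont _)
  have e1 : ∫ t in Ioc a b, t ^ ((D - 1) / p) * w t * t ^ (-((D - 1) / p)) =
      ∫ t in a..b, w t := by
    rw [intervalIntegral.integral_of_le hab]
    refine setIntegral_congr_fun measurableSet_Ioc fun t ht ↦ ?_
    have ht0 := ha.trans ht.1
    have := (Real.rpow_pos_of_pos ht0 ((D - 1) / p)).ne'
    simp only [Real.rpow_neg ht0.le]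
    field_simp
  have e2 : ∫ t in Ioc a b, (t ^ ((D - 1) / p) * w t) ^ p =
      ∫ t in a..b, t ^ (D - 1) * w t ^ p := by
    rw [intervalIntegral.integral_of_le hab]
    refine setIntegral_congr_fun measurableSet_Ioc fun t ht ↦ ?_
    have ht0 := ha.trans ht.1
    simp only [Real.mul_rpow (Real.rpow_nonneg ht0.le _) (hw0 t), ← Real.rpow_mul ht0.le,
      div_mul_cancel₀ _ hp0.ne']
  have e3 : ∫ t in Ioc a b, (t ^ (-((D - 1) / p))) ^ q = ∫ t in a..b, t ^ (-k) := by
    rw [intervalIntegral.integral_of_le hab]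
    refine setIntegral_congr_fun measurableSet_Ioc fun t ht ↦ ?_
    simp only [← Real.rpow_mul (ha.trans ht.1).le]
    congr 1
    rw [neg_mul, div_mul_eq_mul_div, mul_div_assoc, hpq1, hk, mul_one_div]
  rw [e1, e2, e3] at holder
  set J := ∫ t in a..b, t ^ (D - 1) * w t ^ p
  have hJ : 0 ≤ J := intervalIntegral.integral_nonneg hab fun t ht ↦
    mul_nonneg (Real.rpow_nonneg (ha.le.trans ht.1) _) (Real.rpow_nonneg (hw0 t) _)
  have hL : 0 ≤ ∫ t in a..b, t ^ (-k) := intervalIntegral.integral_nonneg hab fun t ht ↦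
    Real.rpow_nonneg (ha.le.trans ht.1) _
  have hW : 0 ≤ ∫ t in a..b, w t := intervalIntegral.integral_nonneg hab fun t _ ↦ hw0 t
  have e4 : 1 / q * p = p - 1 := by rw [hq, Real.conjExponent]; field_simp
  calc
    _ ≤ (J ^ (1 / p) * (∫ t in a..b, t ^ (-k)) ^ (1 / q)) ^ p := by gcongr
    _ = J * (∫ t in a..b, t ^ (-k)) ^ (p - 1) := by
      rw [Real.mul_rpow (by positivity) (by positivity), ← Real.rpow_mul hJ, ← Real.rpow_mul hL,
        e4, one_div_mul_cancel hp0.ne', Real.rpow_one]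
    _ ≤ J * (a ^ (1 - k) / (k - 1)) ^ (p - 1) := by
      gcongr
      exact integral_rpow_neg_le ha hab hk1
    _ = _ := by
      have h1 : k - 1 = (D - p) / (p - 1) := by
        rw [hk]; have : p - 1 ≠ 0 := by linarith
        field_simp; ring
      have h2 : (1 - k) * (p - 1) = p - D := by
        rw [hk]; have : p - 1 ≠ 0 := by linarith
        field_simp; ring
      rw [h1, div_eq_mul_inv, inv_div, Real.mul_rpow (by positivity)
        (div_nonneg (by linarith) (by linarith)), ← Real.rpow_mul ha.le, h2]
      ring

theorem add_rpow_le_two_rpow_mul {p x y : ℝ} (hp : 1 ≤ p) (hx : 0 ≤ x) (hy : 0 ≤ y) :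
    (x + y) ^ p ≤ 2 ^ (p - 1) * (x ^ p + y ^ p) := by
  lift x to ℝ≥0 using hx
  lift y to ℝ≥0 using hy
  exact_mod_cast NNReal.rpow_add_le_mul_rpow_add_rpow x y hp

theorem exists_rpow_mul_abs_rpow_le_integral {p D : ℝ} (hp : 1 < p) (hpD : p < D) :
    ∃ C > (0 : ℝ), ∀ r R : ℝ, 0 < r → r ≤ R → ∀ u u' w : ℝ → ℝ,
      (∀ t, HasDerivAt u (u' t) t) → Continuous u' → Continuous w → (∀ t, |u' t| ≤ w t) →
      r ^ (D - 1) * |u r| ^ p ≤ C * max (r ^ (D - 1) * R ^ (-D)) (r ^ (p - 1)) *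
        ∫ t in (0 : ℝ)..R, t ^ (D - 1) * (|u t| ^ p + w t ^ p) := by
  have hp0 : 0 < p := by linarith
  have hD0 : 0 < D := by linarith
  set c := ((p - 1) / (D - p)) ^ (p - 1)
  have hc0 : 0 < c := Real.rpow_pos_of_pos (div_pos (by linarith) (by linarith)) _
  refine ⟨2 ^ (p - 1) * (c * (1 / 2) ^ (p - D) + 2 ^ D), by positivity, ?_⟩
  intro r R hr hrR u u' w hu hu' hw huw
  have hR : 0 < R := hr.trans_le hrR
  have hw0 : 0 ≤ w := fun t ↦ (abs_nonneg _).trans (huw t)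
  have hucont : Continuous u := continuous_iff_continuousAt.2 fun t ↦ (hu t).continuousAt
  set h : ℝ → ℝ := fun t ↦ t ^ (D - 1) * (|u t| ^ p + w t ^ p) with hh
  have hpowc : Continuous fun t : ℝ ↦ t ^ (D - 1) := Real.continuous_rpow_const (by linarith)
  have hwp : Continuous fun t ↦ w t ^ p := hw.rpow_const fun _ ↦ .inr hp0.le
  have hup : Continuous fun t ↦ |u t| ^ p := hucont.abs.rpow_const fun _ ↦ .inr hp0.le
  have hcont : Continuous h := hpowc.mul (hup.add hwp)
  set I := ∫ t in (0 : ℝ)..R, h t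
  have hnonneg {t : ℝ} (ht : 0 ≤ t) : 0 ≤ h t := mul_nonneg (Real.rpow_nonneg ht _)
    (add_nonneg (Real.rpow_nonneg (abs_nonneg _) _) (Real.rpow_nonneg (hw0 t) _))
  have hI0 : 0 ≤ I := intervalIntegral.integral_nonneg hR.le fun t ht ↦ hnonneg ht.1
  have hmono {a : ℝ} (ha : 0 ≤ a) (haR : a ≤ R) : ∫ t in a..R, h t ≤ I := by
    refine intervalIntegral.integral_mono_interval ha haR le_rfl ?_
      (hcont.intervalIntegrable _ _)
    filter_upwards [ae_restrict_mem measurableSet_Ioc] with t ht using hnonneg ht.1.le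
  set Y := (∫ t in (r / 2)..R, w t) ^ p
  have hYle : Y ≤ c * (1 / 2) ^ (p - D) * r ^ (p - D) * I := by
    have := rpow_integral_le_mul_integral_rpow_mul hp hpD (half_pos hr)
      (show r / 2 ≤ R by linarith) hw hw0
    refine this.trans ?_
    rw [mul_assoc c, mul_assoc c, ← Real.mul_rpow (by norm_num) hr.le, one_div_mul_eq_div,
      mul_assoc]
    gcongr
    refine le_trans ?_ (hmono (half_pos hr).le (by linarith))
    refine intervalIntegral.integral_mono_on (by linarith)
      ((hpowc.mul hwp).intervalIntegrable _ _) (hcont.intervalIntegrable _ _) fun t ht ↦ ?_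
    have ht0 : 0 ≤ t := (half_pos hr).le.trans ht.1
    simp only [hh]
    gcongr
    exact le_add_of_nonneg_left (by positivity)
  have hpt {s : ℝ} (hs : s ∈ Icc (R / 2) R) :
      |u r| ^ p - 2 ^ (p - 1) * Y ≤ 2 ^ (p - 1) * ((R / 2) ^ (1 - D) * h s) := by
    have hs0 : 0 < s := (half_pos hR).trans_le hs.1
    have hdiff : |u r - u s| ≤ ∫ t in (r / 2)..R, w t := by
      rw [← intervalIntegral.integral_eq_sub_of_hasDerivAt (fun t _ ↦ hu t)
        (hu'.intervalIntegrable s r), ← Real.norm_eq_abs]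
      refine intervalIntegral.norm_integral_le_integral_norm_uIoc.trans ?_
      rw [intervalIntegral.integral_of_le (by linarith)]
      refine (setIntegral_mono (hu'.norm.integrableOn_uIoc) hw.integrableOn_uIoc huw).trans ?_
      refine setIntegral_mono_set hw.integrableOn_Ioc (.of_forall hw0) (.of_forall ?_)
      rw [uIoc]
      exact Ioc_subset_Ioc (le_min (by linarith [hs.1]) (by linarith)) (max_le hs.2 hrR)
    have h1 : |u r| ^ p ≤ 2 ^ (p - 1) * (|u s| ^ p + Y) := by
      refine le_trans ?_ (add_rpow_le_two_rpow_mul hp.le (abs_nonneg _)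
        ((abs_nonneg _).trans hdiff))
      gcongr
      calc |u r| = |u s + (u r - u s)| := by ring_nf
        _ ≤ _ := (abs_add_le _ _).trans (by gcongr)
    have h2 : |u s| ^ p ≤ (R / 2) ^ (1 - D) * h s := by
      have h3 : 1 ≤ (R / 2) ^ (1 - D) * s ^ (D - 1) := by
        rw [show 1 - D = -(D - 1) by ring, Real.rpow_neg (by positivity), ← div_eq_inv_mul,
          one_le_div (by positivity)]
        exact Real.rpow_le_rpow (by positivity) hs.1 (by linarith)
      have h4 : 0 ≤ w s ^ p := Real.rpow_nonneg (hw0 s) _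
      calc |u s| ^ p ≤ 1 * (|u s| ^ p + w s ^ p) := by linarith
        _ ≤ (R / 2) ^ (1 - D) * s ^ (D - 1) * (|u s| ^ p + w s ^ p) := by gcongr
        _ = _ := by rw [hh]; ring
    have : (2 : ℝ) ^ (p - 1) * |u s| ^ p ≤ 2 ^ (p - 1) * ((R / 2) ^ (1 - D) * h s) := by gcongr
    linarith
  have hav : R / 2 * (|u r| ^ p - 2 ^ (p - 1) * Y) ≤ 2 ^ (p - 1) * ((R / 2) ^ (1 - D) * I) := by
    have := intervalIntegral.integral_mono_on (μ := volume) (by linarith : R / 2 ≤ R)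
      (g := fun s ↦ 2 ^ (p - 1) * ((R / 2) ^ (1 - D) * h s))
      (continuous_const.intervalIntegrable _ _)
      ((continuous_const.mul (continuous_const.mul hcont)).intervalIntegrable _ _)
      fun s hs ↦ hpt hs
    rw [intervalIntegral.integral_const, intervalIntegral.integral_const_mul,
      intervalIntegral.integral_const_mul, smul_eq_mul, show R - R / 2 = R / 2 by ring] at this
    refine this.trans ?_
    gcongr
    exact hmono (by positivity) (by linarith)
  have hX : |u r| ^ p ≤ 2 ^ (p - 1) * (2 ^ D * R ^ (-D) * I) + 2 ^ (p - 1) * Y := by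
    have e : (R / 2) ^ (1 - D) = R / 2 * (2 ^ D * R ^ (-D)) := by
      rw [Real.rpow_sub (by positivity), Real.rpow_one, Real.div_rpow hR.le (by norm_num),
        Real.rpow_neg hR.le]
      field_simp
    rw [e] at hav
    have := le_of_mul_le_mul_left (hav.trans_eq (show _ = R / 2 *
      (2 ^ (p - 1) * (2 ^ D * R ^ (-D) * I)) by ring)) (half_pos hR)
    linarith
  have hrr : r ^ (D - 1) * r ^ (p - D) = r ^ (p - 1) := by
    rw [← Real.rpow_add hr]; ring_nf
  set M := max (r ^ (D - 1) * R ^ (-D)) (r ^ (p - 1))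
  calc
    r ^ (D - 1) * |u r| ^ p ≤ r ^ (D - 1) * (2 ^ (p - 1) * (2 ^ D * R ^ (-D) * I) +
        2 ^ (p - 1) * (c * (1 / 2) ^ (p - D) * r ^ (p - D) * I)) := by
      gcongr
      exact hX.trans (by gcongr)
    _ = 2 ^ (p - 1) * (c * (1 / 2) ^ (p - D) * (r ^ (D - 1) * r ^ (p - D)) +
        2 ^ D * (r ^ (D - 1) * R ^ (-D))) * I := by ring
    _ ≤ 2 ^ (p - 1) * (c * (1 / 2) ^ (p - D) * M + 2 ^ D * M) * I := by
      rw [hrr]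
      gcongr
      · exact le_max_right _ _
      · exact le_max_left _ _
    _ = _ := by ring

end OneDim

theorem exists_setLIntegral_sphere_le_setIntegral_closedBall (d : ℕ) (hd : 2 ≤ d) (p : ℝ)
    (hp : 1 < p) (hpd : p < d) :
    ∃ C > (0 : ℝ), ∀ r R : ℝ, 0 < r → r ≤ R →
      ∀ f : EuclideanSpace ℝ (Fin d) → ℝ, ContDiff ℝ 1 f →
      ∫⁻ x in sphere (0 : EuclideanSpace ℝ (Fin d)) r,
          ENNReal.ofReal (|f x| ^ p) ∂(μH[(d : ℝ) - 1]) ≤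
        ENNReal.ofReal (C * max (r ^ ((d : ℝ) - 1) * R ^ (-(d : ℝ))) (r ^ (p - 1)) *
          ∫ x in closedBall (0 : EuclideanSpace ℝ (Fin d)) R,
            (|f x| ^ p + ‖fderiv ℝ f x‖ ^ p)) := by
  have : Nonempty (Fin d) := ⟨⟨0, by omega⟩⟩
  have hp0 : 0 ≤ p := by linarith
  have hcast : (d : ℝ) - 1 = ((d - 1 : ℕ) : ℝ) := (Nat.cast_pred (by omega)).symm
  obtain ⟨C₁, hC₁⟩ :=
    exists_setLIntegral_sphere_le (volume : Measure (EuclideanSpace ℝ (Fin d)))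
  obtain ⟨C₂, hC₂0, hC₂⟩ := exists_rpow_mul_abs_rpow_le_integral hp hpd
  simp only [finrank_euclideanSpace, Fintype.card_fin] at hC₁
  refine ⟨(C₁ + 1) * C₂, by positivity, fun r R hr hrR f hf ↦ ?_⟩
  have hR : 0 < R := hr.trans_le hrR
  have hf' : Continuous (fderiv ℝ f) := hf.continuous_fderiv one_ne_zero
  set M := max (r ^ ((d : ℝ) - 1) * R ^ (-(d : ℝ))) (r ^ (p - 1)) with hM
  have hM0 : 0 < M := lt_max_of_lt_right (by positivity)
  have hfp : Continuous fun x ↦ |f x| ^ p := hf.continuous.abs.rpow_const fun _ ↦ .inr hp0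
  set H : EuclideanSpace ℝ (Fin d) → ℝ := fun x ↦ |f x| ^ p + ‖fderiv ℝ f x‖ ^ p with hH
  have hHc : Continuous H := hfp.add (hf'.norm.rpow_const fun _ ↦ .inr hp0)
  have hH0 : 0 ≤ H := fun x ↦ by simp only [hH, Pi.zero_apply]; positivity
  have hray (ω : sphere (0 : EuclideanSpace ℝ (Fin d)) 1) :
      r ^ (d - 1) * |f (r • (ω : EuclideanSpace ℝ (Fin d)))| ^ p ≤ C₂ * M *
        ∫ t in (0 : ℝ)..R, t ^ (d - 1) * H (t • (ω : EuclideanSpace ℝ (Fin d))) := by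
    have h := hC₂ r R hr hrR (fun t ↦ f (t • (ω : EuclideanSpace ℝ (Fin d))))
      (fun t ↦ fderiv ℝ f (t • (ω : EuclideanSpace ℝ (Fin d))) ω)
      (fun t ↦ ‖fderiv ℝ f (t • (ω : EuclideanSpace ℝ (Fin d)))‖) (fun t ↦ ?_)
      (by fun_prop) (by fun_prop) fun t ↦ ?_
    · simp only [← hM] at h
      simpa only [hcast, Real.rpow_natCast] using h
    · have := (hf.differentiable one_ne_zero _).hasFDerivAt.comp_hasDerivAt t
        ((hasDerivAt_id t).smul_const (ω : EuclideanSpace ℝ (Fin d)))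
      simpa [Function.comp_def] using this
    · simpa using (fderiv ℝ f (t • (ω : EuclideanSpace ℝ (Fin d)))).le_opNorm ω
  calc
    _ ≤ C₁ * ∫⁻ ω : sphere (0 : EuclideanSpace ℝ (Fin d)) 1,
          ENNReal.ofReal (r ^ (d - 1) * |f (r • (ω : EuclideanSpace ℝ (Fin d)))| ^ p)
          ∂volume.toSphere := hC₁ r hr _ hfp fun x ↦ Real.rpow_nonneg (abs_nonneg _) _
    _ ≤ C₁ * ∫⁻ ω : sphere (0 : EuclideanSpace ℝ (Fin d)) 1, ENNReal.ofReal (C₂ * M) *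
          ∫⁻ t in Ioi (0 : ℝ), ENNReal.ofReal (t ^ (d - 1)) *
            (closedBall 0 R).indicator (fun x ↦ ENNReal.ofReal (H x))
              (t • (ω : EuclideanSpace ℝ (Fin d)))
          ∂volume ∂volume.toSphere := by
      gcongr with ω
      refine (ENNReal.ofReal_le_ofReal (hray ω)).trans ?_
      have hc : Continuous fun t : ℝ ↦ t ^ (d - 1) * H (t • (ω : EuclideanSpace ℝ (Fin d))) := by
        fun_prop
      rw [ENNReal.ofReal_mul (by positivity), intervalIntegral.integral_of_le hR.le,
        ofReal_integral_eq_lintegral_ofReal hc.integrableOn_Ioc]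
      · refine mul_le_mul' le_rfl ?_
        rw [← lintegral_indicator measurableSet_Ioc, ← lintegral_indicator measurableSet_Ioi]
        refine lintegral_mono fun t ↦ ?_
        by_cases ht : t ∈ Ioc 0 R
        · have hmem : t • (ω : EuclideanSpace ℝ (Fin d)) ∈ closedBall 0 R := by
            simpa [norm_smul, abs_of_pos ht.1] using ht.2
          rw [indicator_of_mem ht, indicator_of_mem (show t ∈ Ioi 0 from ht.1),
            indicator_of_mem hmem, ENNReal.ofReal_mul (pow_nonneg ht.1.le _)]
        · rw [indicator_of_notMem ht]
          exact zero_le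
      · filter_upwards [ae_restrict_mem measurableSet_Ioc] with t ht
        exact mul_nonneg (pow_nonneg ht.1.le _) (hH0 _)
    _ = C₁ * (ENNReal.ofReal (C₂ * M) * ENNReal.ofReal (∫ x in closedBall 0 R, H x)) := by
      have hmeas : Measurable ((closedBall 0 R).indicator fun x ↦ ENNReal.ofReal (H x)) :=
        (ENNReal.measurable_ofReal.comp hHc.measurable).indicator measurableSet_closedBall
      have hpolar := lintegral_eq_lintegral_toSphere volume hmeas
      rw [finrank_euclideanSpace, Fintype.card_fin] at hpolar
      rw [lintegral_const_mul' _ _ ENNReal.ofReal_ne_top, ← hpolar,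
        lintegral_indicator measurableSet_closedBall, ofReal_integral_eq_lintegral_ofReal
          (hHc.continuousOn.integrableOn_compact (isCompact_closedBall _ _)) (.of_forall hH0)]
    _ ≤ _ := by
      rw [← ENNReal.ofReal_mul (by positivity), ← ENNReal.ofReal_coe_nnreal,
        ← ENNReal.ofReal_mul (by positivity)]
      refine ENNReal.ofReal_le_ofReal ?_
      have : 0 ≤ ∫ x in closedBall 0 R, H x := integral_nonneg hH0
      rw [mul_assoc ((C₁ : ℝ) + 1), mul_assoc ((C₁ : ℝ) + 1)]
      gcongr
      linarith

/-- Trace estimate: for `1 < p < d` and `0 < r ≤ R ≤ 1`, there is `C = C(p,d)`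
such that for every smooth `f` on `B(0,R) ⊂ ℝᵈ`,
`∫_{|x|=r} |f|^p dH^{d-1} ≤ C max(r^{d-1} R^{-d}, r^{p-1}) ‖f‖_{W^{1,p}(B(0,R))}^p`. -/
theorem stmt_5 (d : ℕ) (hd : 2 ≤ d) (p : ℝ) (hp : 1 < p) (hpd : p < d) :
    ∃ C > (0 : ℝ), ∀ (r R : ℝ), 0 < r → r ≤ R → R ≤ 1 →
      ∀ f : EuclideanSpace ℝ (Fin d) → ℝ, ContDiff ℝ (⊤ : ℕ∞) f →
      (∫ x in Metric.sphere (0 : EuclideanSpace ℝ (Fin d)) r,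
          |f x| ^ p ∂(μH[(d : ℝ) - 1])) ≤
        C * max (r ^ ((d : ℝ) - 1) * R ^ (-(d : ℝ))) (r ^ (p - 1)) *
          ∫ x in Metric.closedBall (0 : EuclideanSpace ℝ (Fin d)) R,
            (|f x| ^ p + ‖fderiv ℝ f x‖ ^ p) := by
  obtain ⟨C, hC, h⟩ := exists_setLIntegral_sphere_le_setIntegral_closedBall d hd p hp hpd
  refine ⟨C, hC, fun r R hr hrR _ f hf ↦ ?_⟩
  have hfp : Continuous fun x ↦ |f x| ^ p :=
    hf.continuous.abs.rpow_const fun _ ↦ .inr (by linarith)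
  rw [integral_eq_lintegral_of_nonneg_ae
    (.of_forall fun x ↦ Real.rpow_nonneg (abs_nonneg _) _) hfp.aestronglyMeasurable]
  refine ENNReal.toReal_le_of_le_ofReal ?_
    (h r R hr hrR f (hf.of_le (by exact_mod_cast le_top)))
  have hM : 0 ≤ max (r ^ ((d : ℝ) - 1) * R ^ (-(d : ℝ))) (r ^ (p - 1)) :=
    le_max_of_le_right (by positivity)
  exact mul_nonneg (by positivity) (integral_nonneg fun x ↦ by positivity)
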